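/- arXiv:1312.4550 — 5 statements merged into one kernel-verified Lean document; each statement's English description precedes it below -/
import Mathlib

section
/- Let d ≥ 1 and let u : ℤ^d → ℝ be harmonic on all of ℤ^d (i.e. (Δu)(x) = 0 for every x). Then for every k ∈ ℕ and every x ∈ ℤ^d one has (Δ^k (u²))(x) ≥ 0, where Δ^k is the k-th iterate of the discrete Laplacian applied to the pointwise square u². -/
/-- The standard generators of `ℤ^d`: `±e_i`, indexed by `Fin d × Bool`. -/
def latticeGen (d : ℕ) (s : Fin d × Bool) : Fin d → ℤ :=
  fun j => if s.1 = j then (if s.2 then 1 else -1) else 0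

/-- The averaging operator `(A f)(x) = (1/(2d)) ∑_{s ∈ S} f(x+s)`. -/
noncomputable def latticeAvg (d : ℕ) (f : (Fin d → ℤ) → ℝ) : (Fin d → ℤ) → ℝ :=
  fun x => (1 / (2 * (d : ℝ))) * ∑ s : Fin d × Bool, f (x + latticeGen d s)

/-- The discrete Laplacian `Δf = Af − f`. -/
noncomputable def latticeLap (d : ℕ) (f : (Fin d → ℤ) → ℝ) : (Fin d → ℤ) → ℝ :=
  fun x => latticeAvg d f x - f x

theorem latticeLap_const_mul_sum (d : ℕ) {ι : Type*} (t : Finset ι) (c : ℝ)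
    (g : ι → (Fin d → ℤ) → ℝ) :
    latticeLap d (fun y => c * ∑ i ∈ t, g i y) = fun y => c * ∑ i ∈ t, latticeLap d (g i) y := by
  funext y
  simp only [latticeLap, latticeAvg, Finset.sum_sub_distrib, ← Finset.mul_sum]
  rw [Finset.sum_comm]
  ring

theorem latticeLap_iterate_const_mul_sum (d : ℕ) {ι : Type*} (t : Finset ι) (c : ℝ) (k : ℕ)
    (g : ι → (Fin d → ℤ) → ℝ) :
    (latticeLap d)^[k] (fun y => c * ∑ i ∈ t, g i y) =
      fun y => c * ∑ i ∈ t, (latticeLap d)^[k] (g i) y := by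
  induction k generalizing g with
  | zero => rfl
  | succ k ih =>
    simp only [Function.iterate_succ_apply, latticeLap_const_mul_sum, ih]

/-- Differences of a harmonic function along lattice vectors are harmonic. -/
theorem latticeLap_translate_sub_eq_zero (d : ℕ) {u : (Fin d → ℤ) → ℝ}
    (hu : ∀ x, latticeLap d u x = 0) (v x : Fin d → ℤ) :
    latticeLap d (fun y => u (y + v) - u y) x = 0 := by
  have h₁ := hu (x + v)
  have h₂ := hu x
  simp only [latticeLap, latticeAvg, Finset.sum_sub_distrib, add_right_comm x v] at h₁ h₂ ⊢
  linarith

/-- The Laplacian of the square of a harmonic function is its squared gradient. -/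
theorem latticeLap_sq_of_harmonic (d : ℕ) (hd : 1 ≤ d) {u : (Fin d → ℤ) → ℝ}
    (hu : ∀ x, latticeLap d u x = 0) :
    latticeLap d (fun y => (u y) ^ 2) = fun y =>
      (1 / (2 * (d : ℝ))) * ∑ s : Fin d × Bool, (u (y + latticeGen d s) - u y) ^ 2 := by
  funext y
  have hd' : (d : ℝ) ≠ 0 := by positivity
  have hy := hu y
  simp only [latticeLap, latticeAvg] at hy ⊢
  simp only [sub_sq, Finset.sum_add_distrib, Finset.sum_sub_distrib, ← Finset.sum_mul,
    ← Finset.mul_sum, Finset.sum_const, Finset.card_univ, Fintype.card_prod, Fintype.card_fin,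
    Fintype.card_bool, nsmul_eq_mul]
  push_cast
  field_simp at hy ⊢
  linear_combination (2 * u y) * hy

theorem stmt_0 (d : ℕ) (hd : 1 ≤ d) (u : (Fin d → ℤ) → ℝ)
    (hu : ∀ x, latticeLap d u x = 0) :
    ∀ (k : ℕ) (x : Fin d → ℤ), 0 ≤ (latticeLap d)^[k] (fun y => (u y) ^ 2) x := by
  intro k
  induction k generalizing u with
  | zero => exact fun x => sq_nonneg (u x)
  | succ k ih =>
    intro x
    rw [Function.iterate_succ_apply, latticeLap_sq_of_harmonic d hd hu,
      latticeLap_iterate_const_mul_sum d Finset.univ _ k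
        (fun s y => (u (y + latticeGen d s) - u y) ^ 2)]
    exact mul_nonneg (by positivity) (Finset.sum_nonneg fun s _ =>
      ih _ (latticeLap_translate_sub_eq_zero d hu (latticeGen d s)) x)
end

section
/- Let d ≥ 1 and let u : ℝ^d → ℝ be a smooth harmonic function (Δu = 0 everywhere, where Δ = Σ_{i=1}^d ∂²/∂x_i² is the Euclidean Laplacian). Then for every k ∈ ℕ and every x ∈ ℝ^d one has (Δ^k (u²))(x) ≥ 0, where Δ^k denotes the k-th iterate of the Laplacian applied to the pointwise square u². -/
/-- The Euclidean Laplacian `Δf(x) = ∑_i ∂²f/∂x_i²(x)` on `ℝ^d`, where the second partial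
derivative in direction `e_i` is computed as the second derivative at `0` of `t ↦ f(x + t·e_i)`. -/
noncomputable def euclLap (d : ℕ) (f : (Fin d → ℝ) → ℝ) : (Fin d → ℝ) → ℝ :=
  fun x => ∑ i : Fin d, iteratedDeriv 2 (fun t : ℝ => f (x + t • (Pi.single i 1 : Fin d → ℝ))) 0

section DirectionalDerivative

variable {E : Type*} [NormedAddCommGroup E] [NormedSpace ℝ E]

/-- The directional derivative of `f` in the direction `e`, as a function of the base point. -/
noncomputable def dirDeriv (e : E) (f : E → ℝ) : E → ℝ := fun x => fderiv ℝ f x e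

theorem ContDiff.dirDeriv {f : E → ℝ} (hf : ContDiff ℝ (⊤ : ℕ∞) f) (e : E) :
    ContDiff ℝ (⊤ : ℕ∞) (dirDeriv e f) :=
  (hf.fderiv_right (m := (⊤ : ℕ∞)) (by simp)).clm_apply contDiff_const

theorem ContDiff.hasDerivAt_comp_line {f : E → ℝ} (hf : ContDiff ℝ (⊤ : ℕ∞) f) (e x : E) (t : ℝ) :
    HasDerivAt (fun s : ℝ => f (x + s • e)) (_root_.dirDeriv e f (x + t • e)) t := by
  have hline : HasDerivAt (fun s : ℝ => x + s • e) e t := by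
    simpa using ((hasDerivAt_id t).smul_const e).const_add x
  exact ((hf.differentiable (by simp)) (x + t • e)).hasFDerivAt.comp_hasDerivAt t hline

theorem iteratedDeriv_two_comp_line {f : E → ℝ} (hf : ContDiff ℝ (⊤ : ℕ∞) f) (e x : E) :
    iteratedDeriv 2 (fun t : ℝ => f (x + t • e)) 0 = dirDeriv e (dirDeriv e f) x := by
  have h : deriv (fun t : ℝ => f (x + t • e)) = fun t => dirDeriv e f (x + t • e) :=
    funext fun t => (hf.hasDerivAt_comp_line e x t).deriv
  rw [iteratedDeriv_succ, iteratedDeriv_one, h, ((hf.dirDeriv e).hasDerivAt_comp_line e x 0).deriv]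
  simp

theorem dirDeriv_comm {f : E → ℝ} (hf : ContDiff ℝ (⊤ : ℕ∞) f) (e e' : E) :
    dirDeriv e (dirDeriv e' f) = dirDeriv e' (dirDeriv e f) := by
  have hd : Differentiable ℝ (fderiv ℝ f) :=
    (hf.fderiv_right (m := (⊤ : ℕ∞)) (by simp)).differentiable (by simp)
  have key (a b x : E) : dirDeriv a (dirDeriv b f) x = fderiv ℝ (fderiv ℝ f) x a b := by
    have h := (hd x).hasFDerivAt.clm_apply (hasFDerivAt_const b x)
    change fderiv ℝ (fun y => fderiv ℝ f y b) x a = _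
    rw [h.fderiv]
    simp
  funext x
  rw [key, key]
  exact ((hf.of_le (m := 2) (by norm_cast)).contDiffAt.isSymmSndFDerivAt (by simp)) e e'

theorem dirDeriv_sum {ι : Type*} (s : Finset ι) {f : ι → E → ℝ}
    (hf : ∀ i ∈ s, Differentiable ℝ (f i)) (e : E) :
    dirDeriv e (fun x => ∑ i ∈ s, f i x) = fun x => ∑ i ∈ s, dirDeriv e (f i) x := by
  funext x
  simp only [dirDeriv]
  rw [fderiv_fun_sum fun i hi => hf i hi x]
  simp

theorem dirDeriv_mul {f g : E → ℝ} (hf : Differentiable ℝ f) (hg : Differentiable ℝ g) (e x : E) :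
    dirDeriv e (fun y => f y * g y) x = f x * dirDeriv e g x + g x * dirDeriv e f x := by
  simp [dirDeriv, fderiv_fun_mul (hf x) (hg x)]

theorem dirDeriv_const_mul {f : E → ℝ} (hf : Differentiable ℝ f) (c : ℝ) (e : E) :
    dirDeriv e (fun y => c * f y) = fun x => c * dirDeriv e f x := by
  funext x
  simp [dirDeriv, fderiv_const_mul (hf x)]

theorem dirDeriv_dirDeriv_sq {f : E → ℝ} (hf : ContDiff ℝ (⊤ : ℕ∞) f) (e x : E) :
    dirDeriv e (dirDeriv e fun y => f y ^ 2) x =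
      2 * f x * dirDeriv e (dirDeriv e f) x + 2 * dirDeriv e f x ^ 2 := by
  have h₀ : Differentiable ℝ f := hf.differentiable (by simp)
  have h₁ : Differentiable ℝ (dirDeriv e f) := (hf.dirDeriv e).differentiable (by simp)
  have h : (dirDeriv e fun y => f y ^ 2) = fun y => 2 * (f y * dirDeriv e f y) := by
    funext y
    simp only [pow_two]
    rw [dirDeriv_mul h₀ h₀]
    ring
  rw [h, dirDeriv_const_mul (h₀.fun_mul h₁)]
  beta_reduce
  rw [dirDeriv_mul h₀ h₁]
  ring

end DirectionalDerivative

section EuclideanLaplacian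

variable {d : ℕ}

theorem euclLap_eq_sum_dirDeriv {f : (Fin d → ℝ) → ℝ} (hf : ContDiff ℝ (⊤ : ℕ∞) f) :
    euclLap d f = fun x => ∑ i, dirDeriv (Pi.single i 1) (dirDeriv (Pi.single i 1) f) x :=
  funext fun x => Finset.sum_congr rfl fun _ _ => iteratedDeriv_two_comp_line hf _ x

theorem euclLap_dirDeriv {f : (Fin d → ℝ) → ℝ} (hf : ContDiff ℝ (⊤ : ℕ∞) f) (e : Fin d → ℝ) :
    euclLap d (dirDeriv e f) = dirDeriv e (euclLap d f) := by
  rw [euclLap_eq_sum_dirDeriv (hf.dirDeriv e), euclLap_eq_sum_dirDeriv hf,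
    dirDeriv_sum _ fun i _ => ((hf.dirDeriv _).dirDeriv _).differentiable (by simp)]
  simp only [dirDeriv_comm (hf.dirDeriv _) e, dirDeriv_comm hf e]

theorem euclLap_const_mul {f : (Fin d → ℝ) → ℝ} (hf : ContDiff ℝ (⊤ : ℕ∞) f) (c : ℝ) :
    euclLap d (fun x => c * f x) = fun x => c * euclLap d f x := by
  rw [euclLap_eq_sum_dirDeriv (contDiff_const.mul hf), euclLap_eq_sum_dirDeriv hf]
  funext x
  rw [Finset.mul_sum]
  refine Finset.sum_congr rfl fun i _ => ?_
  rw [dirDeriv_const_mul (hf.differentiable (by simp)),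
    dirDeriv_const_mul ((hf.dirDeriv _).differentiable (by simp))]

/-- The Laplacian of a sum of squares of harmonic functions is again a sum of squares, namely of
`√2` times their partial derivatives. -/
theorem euclLap_sum_sq {ι : Type*} [Fintype ι] {v : ι → (Fin d → ℝ) → ℝ}
    (hv : ∀ j, ContDiff ℝ (⊤ : ℕ∞) (v j)) (hharm : ∀ j, euclLap d (v j) = 0) :
    euclLap d (fun x => ∑ j, v j x ^ 2) =
      fun x => ∑ p : ι × Fin d, (√2 * dirDeriv (Pi.single p.2 1) (v p.1) x) ^ 2 := by
  have hsq (j : ι) : ContDiff ℝ (⊤ : ℕ∞) fun x => v j x ^ 2 := (hv j).pow 2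
  rw [euclLap_eq_sum_dirDeriv (ContDiff.sum fun j _ => hsq j)]
  funext x
  rw [Fintype.sum_prod_type]
  have hsum (i : Fin d) : dirDeriv (Pi.single i 1) (dirDeriv (Pi.single i 1)
      fun x => ∑ j, v j x ^ 2) x =
      ∑ j, dirDeriv (Pi.single i 1) (dirDeriv (Pi.single i 1) fun x => v j x ^ 2) x := by
    rw [dirDeriv_sum _ fun j _ => (hsq j).differentiable (by simp),
      dirDeriv_sum _ fun j _ => ((hsq j).dirDeriv _).differentiable (by simp)]
  simp only [hsum]
  rw [Finset.sum_comm]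
  refine Finset.sum_congr rfl fun j _ => ?_
  have hj : ∑ i, dirDeriv (Pi.single i 1) (dirDeriv (Pi.single i 1) (v j)) x = 0 := by
    have h := congrFun (hharm j) x
    rwa [euclLap_eq_sum_dirDeriv (hv j)] at h
  simp only [dirDeriv_dirDeriv_sq (hv j), Finset.sum_add_distrib, ← Finset.mul_sum, hj, mul_pow]
  simp

theorem iterate_euclLap_sum_sq_nonneg (k : ℕ) {ι : Type} [Fintype ι] {v : ι → (Fin d → ℝ) → ℝ}
    (hv : ∀ j, ContDiff ℝ (⊤ : ℕ∞) (v j)) (hharm : ∀ j, euclLap d (v j) = 0) (x : Fin d → ℝ) :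
    0 ≤ (euclLap d)^[k] (fun y => ∑ j, v j y ^ 2) x := by
  induction k generalizing ι with
  | zero => exact Finset.sum_nonneg fun j _ => sq_nonneg _
  | succ k ih =>
    rw [Function.iterate_succ_apply, euclLap_sum_sq hv hharm]
    refine ih (v := fun (p : ι × Fin d) y => √2 * dirDeriv (Pi.single p.2 1) (v p.1) y)
      (fun p => contDiff_const.mul ((hv p.1).dirDeriv _)) fun p => ?_
    rw [euclLap_const_mul ((hv p.1).dirDeriv _), euclLap_dirDeriv (hv p.1), hharm]
    funext y
    simp [dirDeriv]

end EuclideanLaplacian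

theorem stmt_1 (d : ℕ) (hd : 1 ≤ d) (u : (Fin d → ℝ) → ℝ)
    (hsmooth : ContDiff ℝ (⊤ : ℕ∞) u) (hu : ∀ x, euclLap d u x = 0) :
    ∀ (k : ℕ) (x : Fin d → ℝ), 0 ≤ (euclLap d)^[k] (fun y => (u y) ^ 2) x := by
  intro k x
  simpa using iterate_euclLap_sum_sq_nonneg k (v := fun _ : Unit => u) (fun _ => hsmooth)
    (fun _ => funext hu) x
end

section
/- Let d ≥ 1 and let u : ℤ^d → ℝ be harmonic on all of ℤ^d. Define Q_u(n) = (Aⁿ(u²))(0). Then Q_u : ℕ → ℝ is absolutely monotonic in the discrete sense: for all k, n ∈ ℕ the iterated forward difference satisfies Q_u^{(k)}(n) ≥ 0. -/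
/-- The growth function `Q_u(n) = (Aⁿ (u²))(0)`. -/
noncomputable def growthQ (d : ℕ) (u : (Fin d → ℤ) → ℝ) (n : ℕ) : ℝ :=
  (latticeAvg d)^[n] (fun y => (u y) ^ 2) 0

/-- Forward difference of a function on `ℕ`. -/
def fdiff (g : ℕ → ℝ) : ℕ → ℝ := fun n => g (n + 1) - g n

theorem latticeAvg_const_mul_sum {ι : Type*} [Fintype ι] (d : ℕ) (c : ℝ)
    (f : ι → (Fin d → ℤ) → ℝ) :
    latticeAvg d (fun y => c * ∑ i, f i y) = fun y => c * ∑ i, latticeAvg d (f i) y := by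
  funext x
  simp only [latticeAvg, ← Finset.mul_sum]
  rw [Finset.sum_comm]
  ring

theorem latticeAvg_iterate_const_mul_sum {ι : Type*} [Fintype ι] (d : ℕ) (c : ℝ) (n : ℕ)
    (f : ι → (Fin d → ℤ) → ℝ) :
    (latticeAvg d)^[n] (fun y => c * ∑ i, f i y) =
      fun y => c * ∑ i, (latticeAvg d)^[n] (f i) y := by
  induction n generalizing f with
  | zero => rfl
  | succ n ih => simp only [Function.iterate_succ_apply, latticeAvg_const_mul_sum, ih]

theorem latticeAvg_sub (d : ℕ) (f g : (Fin d → ℤ) → ℝ) :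
    latticeAvg d (f - g) = latticeAvg d f - latticeAvg d g := by
  funext x
  simp only [latticeAvg, Pi.sub_apply, Finset.sum_sub_distrib, mul_sub]

theorem latticeAvg_iterate_sub (d n : ℕ) (f g : (Fin d → ℤ) → ℝ) :
    (latticeAvg d)^[n] (f - g) = (latticeAvg d)^[n] f - (latticeAvg d)^[n] g := by
  induction n generalizing f g with
  | zero => rfl
  | succ n ih => simp only [Function.iterate_succ_apply, latticeAvg_sub, ih]

theorem fdiff_iterate_const_mul_sum {ι : Type*} [Fintype ι] (c : ℝ) (k : ℕ) (g : ι → ℕ → ℝ) :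
    fdiff^[k] (fun n => c * ∑ i, g i n) = fun n => c * ∑ i, fdiff^[k] (g i) n := by
  induction k generalizing g with
  | zero => rfl
  | succ k ih =>
    have h : fdiff (fun n => c * ∑ i, g i n) = fun n => c * ∑ i, fdiff (g i) n := by
      funext n
      simp only [fdiff, Finset.sum_sub_distrib, mul_sub]
    simp only [Function.iterate_succ_apply, h, ih]

/-- For harmonic `u`, the Laplacian of `u ^ 2` is the mean square of the directional differences
of `u`. -/
theorem latticeLap_sq {d : ℕ} (hd : 1 ≤ d) {u : (Fin d → ℤ) → ℝ}
    (hu : ∀ x, latticeLap d u x = 0) :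
    latticeLap d (fun y => u y ^ 2) =
      fun x => (1 / (2 * (d : ℝ))) * ∑ s : Fin d × Bool, (u (x + latticeGen d s) - u x) ^ 2 := by
  funext x
  have hd' : (d : ℝ) ≠ 0 := by positivity
  have h := hu x
  simp only [latticeLap, latticeAvg] at h ⊢
  have key : ∑ s : Fin d × Bool, (u (x + latticeGen d s) - u x) ^ 2 =
      ∑ s : Fin d × Bool, u (x + latticeGen d s) ^ 2
        - 2 * u x * ∑ s : Fin d × Bool, u (x + latticeGen d s) + 2 * d * u x ^ 2 := by
    simp only [sub_sq, Finset.sum_add_distrib, Finset.sum_sub_distrib, Finset.mul_sum,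
      Finset.sum_const, Finset.card_univ, Fintype.card_prod, Fintype.card_fin, Fintype.card_bool,
      nsmul_eq_mul]
    push_cast
    congr 2
    · exact Finset.sum_congr rfl fun _ _ => by ring
    · ring
  have hs : ∑ s : Fin d × Bool, u (x + latticeGen d s) = 2 * d * u x := by
    field_simp at h
    linarith
  rw [key, hs]
  field_simp
  ring

theorem latticeLap_directional_difference {d : ℕ} {u : (Fin d → ℤ) → ℝ}
    (hu : ∀ x, latticeLap d u x = 0) (v x : Fin d → ℤ) :
    latticeLap d (fun y => u (y + v) - u y) x = 0 := by
  have h₁ := hu x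
  have h₂ := hu (x + v)
  simp only [latticeLap, latticeAvg, Finset.sum_sub_distrib, mul_sub, add_right_comm x _ v]
    at h₁ h₂ ⊢
  linarith

theorem fdiff_growthQ {d : ℕ} (hd : 1 ≤ d) {u : (Fin d → ℤ) → ℝ}
    (hu : ∀ x, latticeLap d u x = 0) :
    fdiff (growthQ d u) = fun n => (1 / (2 * (d : ℝ))) *
      ∑ s : Fin d × Bool, growthQ d (fun y => u (y + latticeGen d s) - u y) n := by
  funext n
  have h : latticeAvg d (fun y => u y ^ 2) - (fun y => u y ^ 2) = _ := latticeLap_sq hd hu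
  have h' := congrFun (latticeAvg_iterate_sub d n (latticeAvg d fun y => u y ^ 2)
    fun y => u y ^ 2) 0
  rw [h, latticeAvg_iterate_const_mul_sum d _ n
    (fun s y => (u (y + latticeGen d s) - u y) ^ 2)] at h'
  exact h'.symm

theorem latticeAvg_iterate_nonneg {d : ℕ} (n : ℕ) {f : (Fin d → ℤ) → ℝ} (hf : ∀ x, 0 ≤ f x)
    (x : Fin d → ℤ) : 0 ≤ (latticeAvg d)^[n] f x := by
  induction n generalizing f with
  | zero => exact hf x
  | succ n ih =>
    exact ih fun y => mul_nonneg (by positivity) (Finset.sum_nonneg fun s _ => hf _)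

theorem stmt_5 (d : ℕ) (hd : 1 ≤ d) (u : (Fin d → ℤ) → ℝ)
    (hu : ∀ x, latticeLap d u x = 0) :
    ∀ k n : ℕ, 0 ≤ fdiff^[k] (growthQ d u) n := by
  intro k n
  induction k generalizing u with
  | zero => exact latticeAvg_iterate_nonneg n (fun x => sq_nonneg (u x)) 0
  | succ k ih =>
    rw [Function.iterate_succ_apply, fdiff_growthQ hd hu, fdiff_iterate_const_mul_sum]
    exact mul_nonneg (by positivity) (Finset.sum_nonneg fun s _ =>
      ih _ (latticeLap_directional_difference hu _))
end

section
/- Let d ≥ 1, let u : ℤ^d → ℝ be harmonic on all of ℤ^d, and let t > 0. Define the continuous-time growth function Q_{c,u}(t) = Σ_{n=0}^∞ e^{−t} (tⁿ/n!) Q_u(n), where Q_u(n) = (Aⁿ(u²))(0). Assume that the series Σ_{n=0}^∞ ((4t)ⁿ/n!) Q_u(n) converges (so Q_{c,u}(s) is finite for all 0 < s ≤ 4t). Then Q_{c,u}(2t) ≤ √(Q_{c,u}(t) · Q_{c,u}(4t)). -/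
/-- The continuous-time growth function `Q_{c,u}(t) = ∑ e^{−t} tⁿ/n! · Q_u(n)`. -/
noncomputable def growthQc (d : ℕ) (u : (Fin d → ℤ) → ℝ) (t : ℝ) : ℝ :=
  ∑' n : ℕ, Real.exp (-t) * t ^ n / (n.factorial : ℝ) * growthQ d u n

/-- The averaging operator as a linear endomorphism. -/
noncomputable def latticeAvgLin (d : ℕ) : Module.End ℝ ((Fin d → ℤ) → ℝ) where
  toFun := latticeAvg d
  map_add' f g := by
    ext x
    simp only [latticeAvg, Pi.add_apply, Finset.sum_add_distrib, mul_add]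
  map_smul' c f := by
    ext x
    simp only [latticeAvg, Pi.smul_apply, smul_eq_mul, ← Finset.mul_sum, RingHom.id_apply]
    ring

theorem latticeAvg_eq_of_latticeLap_eq_zero {d : ℕ} {v : (Fin d → ℤ) → ℝ}
    (hv : ∀ x, latticeLap d v x = 0) (x : Fin d → ℤ) : latticeAvg d v x = v x :=
  sub_eq_zero.mp (hv x)

theorem latticeLap_translate_sub {d : ℕ} {v : (Fin d → ℤ) → ℝ}
    (hv : ∀ x, latticeLap d v x = 0) (a x : Fin d → ℤ) :
    latticeLap d (fun y => v (y + a) - v y) x = 0 := by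
  have h₁ := hv (x + a)
  have h₂ := hv x
  simp only [latticeLap, latticeAvg, Finset.sum_sub_distrib, mul_sub] at *
  simp only [add_right_comm x a] at h₁
  linarith

/-- The Laplacian of the square of a harmonic function is the mean squared gradient. -/
theorem latticeAvgLin_sub_one_sq {d : ℕ} (hd : 1 ≤ d) {v : (Fin d → ℤ) → ℝ}
    (hv : ∀ x, latticeLap d v x = 0) :
    (latticeAvgLin d - 1) (fun y => v y ^ 2) =
      (1 / (2 * (d : ℝ))) • ∑ s : Fin d × Bool, fun y => (v (y + latticeGen d s) - v y) ^ 2 := by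
  ext x
  have h := latticeAvg_eq_of_latticeLap_eq_zero hv x
  have hd' : (d : ℝ) ≠ 0 := by positivity
  change latticeAvg d (fun y => v y ^ 2) x - v x ^ 2 = _
  simp only [Pi.smul_apply, Finset.sum_apply, smul_eq_mul, latticeAvg] at *
  have e : ∑ s : Fin d × Bool, (v (x + latticeGen d s) - v x) ^ 2 =
      ∑ s : Fin d × Bool, v (x + latticeGen d s) ^ 2
        - 2 * v x * ∑ s : Fin d × Bool, v (x + latticeGen d s) + 2 * d * v x ^ 2 := by
    simp only [sub_sq, Finset.sum_add_distrib, Finset.sum_sub_distrib, Finset.mul_sum,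
      Finset.sum_const, Finset.card_univ, Fintype.card_prod, Fintype.card_fin, Fintype.card_bool,
      nsmul_eq_mul, Nat.cast_mul, Nat.cast_ofNat]
    congr 1
    · congr 1
      exact Finset.sum_congr rfl fun s _ => by ring
    · ring
  rw [e]
  field_simp at h ⊢
  rw [h]
  ring

theorem latticeAvgLin_sub_one_pow_sq_nonneg {d : ℕ} (hd : 1 ≤ d) (k : ℕ)
    {v : (Fin d → ℤ) → ℝ} (hv : ∀ x, latticeLap d v x = 0) (x : Fin d → ℤ) :
    0 ≤ ((latticeAvgLin d - 1) ^ k) (fun y => v y ^ 2) x := by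
  induction k generalizing v with
  | zero => simpa using sq_nonneg (v x)
  | succ k ih =>
    rw [pow_succ, Module.End.mul_apply, latticeAvgLin_sub_one_sq hd hv, map_smul, map_sum]
    simp only [Pi.smul_apply, Finset.sum_apply, smul_eq_mul]
    exact mul_nonneg (by positivity)
      (Finset.sum_nonneg fun s _ => ih (latticeLap_translate_sub hv (latticeGen d s)))

theorem growthQ_eq_sum_antidiagonal (d : ℕ) (u : (Fin d → ℤ) → ℝ) (n : ℕ) :
    growthQ d u n = ∑ p ∈ Finset.HasAntidiagonal.antidiagonal n,
      (n.choose p.1 : ℝ) * ((latticeAvgLin d - 1) ^ p.1) (fun y => u y ^ 2) 0 := by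
  have h : growthQ d u n = (latticeAvgLin d ^ n) (fun y => u y ^ 2) 0 := by
    rw [Module.End.pow_apply]; rfl
  rw [h, ← sub_add_cancel (latticeAvgLin d) 1, (Commute.one_right _).add_pow']
  simp [LinearMap.sum_apply, Finset.sum_apply]

/-- If `Q n = ∑ C(n,k) D k` then the exponential generating function of `Q` is `exp` times
that of `D`. -/
theorem tsum_exp_mul_binomial {Q D : ℕ → ℝ} {s : ℝ}
    (hQ : ∀ n, Q n = ∑ p ∈ Finset.HasAntidiagonal.antidiagonal n, (n.choose p.1 : ℝ) * D p.1)
    (hs : Summable fun k : ℕ => ‖D k * s ^ k / k.factorial‖) :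
    ∑' n : ℕ, Real.exp (-s) * s ^ n / n.factorial * Q n = ∑' k : ℕ, D k * s ^ k / k.factorial := by
  have hexp : Summable fun m : ℕ => ‖s ^ m / (m.factorial : ℝ)‖ :=
    (Real.summable_pow_div_factorial s).norm
  have hprod := tsum_mul_tsum_eq_tsum_sum_antidiagonal_of_summable_norm hs hexp
  have hE : ∑' m : ℕ, s ^ m / (m.factorial : ℝ) = Real.exp s := by
    rw [Real.exp_eq_exp_ℝ, NormedSpace.exp_eq_tsum_div]
  have hterm : ∀ n : ℕ, Real.exp (-s) * s ^ n / n.factorial * Q n = Real.exp (-s) *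
      ∑ p ∈ Finset.HasAntidiagonal.antidiagonal n,
        D p.1 * s ^ p.1 / p.1.factorial * (s ^ p.2 / p.2.factorial) := by
    intro n
    rw [hQ, mul_div_assoc, mul_assoc, Finset.mul_sum]
    congr 1
    refine Finset.sum_congr rfl fun p hp => ?_
    obtain rfl := Finset.HasAntidiagonal.mem_antidiagonal.mp hp
    rw [Nat.cast_add_choose]
    field_simp
    ring
  simp_rw [hterm]
  rw [tsum_mul_left, ← hprod, hE, mul_left_comm, ← Real.exp_add]
  simp

/-- Log-convexity in `log t`, at the points `t`, `2t`, `4t`, of a power series with nonnegative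
coefficients. -/
theorem tsum_two_mul_le_sqrt {a : ℕ → ℝ} (ha : ∀ k, 0 ≤ a k) {t : ℝ} (ht : 0 ≤ t)
    (h₁ : Summable fun k => a k * t ^ k) (h₄ : Summable fun k => a k * (4 * t) ^ k) :
    ∑' k, a k * (2 * t) ^ k ≤ √((∑' k, a k * t ^ k) * ∑' k, a k * (4 * t) ^ k) := by
  have hn : ∀ c : ℝ, 0 ≤ c → ∀ k, 0 ≤ a k * c ^ k :=
    fun c hc k => mul_nonneg (ha k) (pow_nonneg hc k)
  refine Real.tsum_le_of_sum_le (hn _ (by positivity)) fun F => Real.le_sqrt_of_sq_le ?_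
  refine (Finset.sum_sq_le_sum_mul_sum_of_sq_le_mul F (fun k _ => hn t ht k)
    (fun k _ => hn (4 * t) (by positivity) k) fun k _ => ?_).trans ?_
  · have : ((2 : ℝ) ^ k) ^ 2 = 4 ^ k := by rw [← pow_mul, mul_comm, pow_mul]; norm_num
    simp only [mul_pow]
    rw [this]
    exact le_of_eq (by ring)
  · exact mul_le_mul (h₁.sum_le_tsum F fun k _ => hn t ht k)
      (h₄.sum_le_tsum F fun k _ => hn (4 * t) (by positivity) k)
      (Finset.sum_nonneg fun k _ => hn (4 * t) (by positivity) k) (tsum_nonneg (hn t ht))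

theorem stmt_9 (d : ℕ) (hd : 1 ≤ d) (u : (Fin d → ℤ) → ℝ)
    (hu : ∀ x, latticeLap d u x = 0) (t : ℝ) (ht : 0 < t)
    (hsum : Summable (fun n : ℕ => (4 * t) ^ n / (n.factorial : ℝ) * growthQ d u n)) :
    growthQc d u (2 * t) ≤ Real.sqrt (growthQc d u t * growthQc d u (4 * t)) := by
  set D : ℕ → ℝ := fun k => ((latticeAvgLin d - 1) ^ k) (fun y => u y ^ 2) 0
  have hD : ∀ k, 0 ≤ D k := fun k => latticeAvgLin_sub_one_pow_sq_nonneg hd k hu 0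
  have hQ : ∀ n, growthQ d u n =
      ∑ p ∈ Finset.HasAntidiagonal.antidiagonal n, (n.choose p.1 : ℝ) * D p.1 :=
    growthQ_eq_sum_antidiagonal d u
  have hDQ : ∀ n, D n ≤ growthQ d u n := fun n => by
    rw [hQ]
    simpa using Finset.single_le_sum (s := Finset.HasAntidiagonal.antidiagonal n)
      (f := fun p => (n.choose p.1 : ℝ) * D p.1)
      (fun p _ => mul_nonneg (by positivity) (hD p.1)) (a := (n, 0)) (by simp)
  have hS : ∀ s, 0 ≤ s → s ≤ 4 * t → Summable fun k : ℕ => D k * s ^ k / k.factorial := by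
    intro s hs hst
    refine hsum.of_nonneg_of_le
      (fun k => div_nonneg (mul_nonneg (hD k) (pow_nonneg hs k)) (by positivity)) fun k => ?_
    rw [mul_div_assoc, mul_comm]
    exact mul_le_mul (by gcongr) (hDQ k) (hD k) (by positivity)
  have hG : ∀ s, 0 ≤ s → s ≤ 4 * t →
      growthQc d u s = ∑' k : ℕ, D k / k.factorial * s ^ k := by
    intro s hs hst
    simp_rw [div_mul_eq_mul_div]
    exact tsum_exp_mul_binomial hQ (hS s hs hst).norm
  rw [hG t (by linarith) (by linarith), hG (2 * t) (by linarith) (by linarith),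
    hG (4 * t) (by linarith) le_rfl]
  refine tsum_two_mul_le_sqrt (fun k => div_nonneg (hD k) (by positivity)) ht.le ?_ ?_
  · simpa only [div_mul_eq_mul_div] using hS t ht.le (by linarith)
  · simpa only [div_mul_eq_mul_div] using hS (4 * t) (by linarith) le_rfl
end

section
/- For every ε > 0, every n₀ ∈ ℕ and every C > 0 there exists d₀ ∈ ℕ such that for every dimension d > d₀ there exist a function u : ℤ^d → ℝ harmonic on all of ℤ^d and a natural number n > n₀ with Q_u(2n) > C · √( Q_u(n) · Q_u(4n) ) + 2^{−n^{0.5+ε}} · Q_u(4n), where Q_u(m) = (A^m(u²))(0). -/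
lemma add_latticeGen (d : ℕ) (x : Fin d → ℤ) (i : Fin d) (b : Bool) :
    x + latticeGen d (i, b) = Function.update x i (x i + if b then 1 else -1) := by
  ext j
  by_cases h : i = j
  · subst h
    simp [latticeGen]
  · simp [latticeGen, h, Function.update_of_ne (Ne.symm h)]

lemma prod_update_coord {d : ℕ} (g : ℤ → ℝ) (S : Finset (Fin d)) (x : Fin d → ℤ) (i : Fin d)
    (t : ℤ) :
    ∏ j ∈ S, g (Function.update x i t j) =
      if i ∈ S then g t * ∏ j ∈ S.erase i, g (x j) else ∏ j ∈ S, g (x j) := by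
  have off (T : Finset (Fin d)) (hT : i ∉ T) :
      ∏ j ∈ T, g (Function.update x i t j) = ∏ j ∈ T, g (x j) :=
    Finset.prod_congr rfl fun j hj => by
      rw [Function.update_of_ne (ne_of_mem_of_not_mem hj hT)]
  split_ifs with h
  · rw [← Finset.mul_prod_erase S _ h, off _ (Finset.notMem_erase i S), Function.update_self]
  · exact off S h

/-- The averaging operator on products of one-variable functions with constant second difference. -/
lemma latticeAvg_prod {d : ℕ} (hd : 0 < d) (g : ℤ → ℝ) (c : ℝ)
    (hg : ∀ t, g (t + 1) + g (t - 1) = 2 * g t + 2 * c) (S : Finset (Fin d)) :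
    latticeAvg d (fun x => ∏ j ∈ S, g (x j)) =
      (fun x => ∏ j ∈ S, g (x j)) + (c / d) • ∑ i ∈ S, fun x => ∏ j ∈ S.erase i, g (x j) := by
  ext x
  have hd' : (d : ℝ) ≠ 0 := by positivity
  have step (i : Fin d) : ∑ b : Bool, ∏ j ∈ S, g ((x + latticeGen d (i, b)) j) =
      2 * ∏ j ∈ S, g (x j) + if i ∈ S then 2 * c * ∏ j ∈ S.erase i, g (x j) else 0 := by
    simp only [add_latticeGen, prod_update_coord, Fintype.sum_bool, if_true, Bool.false_eq_true,
      if_false]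
    split_ifs with h
    · rw [← Finset.mul_prod_erase S _ h, ← sub_eq_add_neg]
      linear_combination (∏ j ∈ S.erase i, g (x j)) * hg (x i)
    · ring
  simp only [latticeAvg, Fintype.sum_prod_type]
  rw [Finset.sum_congr rfl fun i _ => step i]
  simp only [Finset.sum_add_distrib, Finset.sum_const,
    Finset.sum_ite_mem, Finset.univ_inter, Finset.card_univ, Fintype.card_fin, nsmul_eq_mul,
    ← Finset.mul_sum, Pi.add_apply, Pi.smul_apply, Finset.sum_apply, smul_eq_mul]
  field_simp

lemma latticeAvg_add (d : ℕ) (f g : (Fin d → ℤ) → ℝ) :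
    latticeAvg d (f + g) = latticeAvg d f + latticeAvg d g := by
  ext x
  simp [latticeAvg, Finset.sum_add_distrib, mul_add]

lemma latticeAvg_smul (d : ℕ) (c : ℝ) (f : (Fin d → ℤ) → ℝ) :
    latticeAvg d (c • f) = c • latticeAvg d f := by
  ext x
  simp only [latticeAvg, Pi.smul_apply, smul_eq_mul, ← Finset.mul_sum]
  ring

/-- The averaging operator as a linear map. -/
noncomputable def latticeAvgLinear (d : ℕ) :
    ((Fin d → ℤ) → ℝ) →ₗ[ℝ] ((Fin d → ℤ) → ℝ) where
  toFun := latticeAvg d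
  map_add' := latticeAvg_add d
  map_smul' := latticeAvg_smul d

lemma iterate_latticeAvg (d m : ℕ) (f : (Fin d → ℤ) → ℝ) :
    (latticeAvg d)^[m] f = (latticeAvgLinear d ^ m) f := by
  rw [Module.End.pow_apply]
  rfl

lemma iterate_latticeAvg_prod_sq {d : ℕ} (hd : 0 < d) (m : ℕ) (S : Finset (Fin d)) :
    (latticeAvg d)^[m] (fun x => ∏ j ∈ S, (x j : ℝ) ^ 2) 0 =
      (m.descFactorial S.card : ℝ) / (d : ℝ) ^ S.card := by
  have hd' : (d : ℝ) ≠ 0 := by positivity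
  induction m generalizing S with
  | zero =>
    rcases S.eq_empty_or_nonempty with rfl | ⟨i, hi⟩
    · simp
    · obtain ⟨k, hk⟩ := Nat.exists_eq_succ_of_ne_zero (Finset.card_ne_zero_of_mem hi)
      simp [hk, Finset.prod_eq_zero hi]
  | succ m ih =>
    have avg := latticeAvg_prod hd (fun t : ℤ => (t : ℝ) ^ 2) 1
      (fun t => by push_cast; ring) S
    rw [Function.iterate_succ_apply, avg, iterate_latticeAvg, map_add, map_smul, map_sum]
    simp only [← iterate_latticeAvg, Pi.add_apply, Pi.smul_apply, Finset.sum_apply, smul_eq_mul,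
      ih]
    rw [Finset.sum_congr rfl fun i hi => by rw [Finset.card_erase_of_mem hi], Finset.sum_const,
      nsmul_eq_mul]
    cases h : S.card with
    | zero => simp
    | succ k =>
      have key : (m + 1).descFactorial (k + 1) =
          m.descFactorial (k + 1) + (k + 1) * m.descFactorial k := by
        rw [Nat.succ_descFactorial_succ, Nat.descFactorial_succ, ← add_mul]
        rcases le_or_gt k m with hkm | hkm
        · congr 1
          omega
        · simp [Nat.descFactorial_of_lt hkm]
      rw [key]
      push_cast
      field_simp
      ring

lemma growthQ_prod_coord {d : ℕ} (hd : 0 < d) (m : ℕ) (S : Finset (Fin d)) :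
    growthQ d (fun x => ∏ j ∈ S, (x j : ℝ)) m =
      (m.descFactorial S.card : ℝ) / (d : ℝ) ^ S.card := by
  simp only [growthQ, ← Finset.prod_pow]
  exact iterate_latticeAvg_prod_sq hd m S

lemma latticeLap_prod_coord {d : ℕ} (hd : 0 < d) (S : Finset (Fin d)) (x : Fin d → ℤ) :
    latticeLap d (fun x => ∏ j ∈ S, (x j : ℝ)) x = 0 := by
  have avg := latticeAvg_prod hd (fun t : ℤ => (t : ℝ)) 0 (fun t => by push_cast; ring) S
  rw [latticeLap, avg]
  simp

lemma cast_descFactorial_succ {m k : ℕ} (h : k ≤ m) :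
    (m.descFactorial (k + 1) : ℝ) = (m - k) * m.descFactorial k := by
  rw [Nat.descFactorial_succ]
  push_cast [Nat.cast_sub h]
  rfl

/-- Quantitative failure of log-convexity of `m ↦ m.descFactorial k` along `n, 2n, 4n`. -/
lemma descFactorial_sq_ge {n k : ℕ} (h : k ≤ n) :
    (8 * n + k * (k - 1) : ℝ) * (n.descFactorial k * (4 * n).descFactorial k) ≤
      8 * n * ((2 * n).descFactorial k : ℝ) ^ 2 := by
  induction k with
  | zero => simp
  | succ k ih =>
    have ih := ih (by omega)
    rw [cast_descFactorial_succ (m := n) (by omega),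
      cast_descFactorial_succ (m := 4 * n) (by omega),
      cast_descFactorial_succ (m := 2 * n) (by omega)]
    have hk : (k : ℝ) + 1 ≤ n := by exact_mod_cast h
    have hk0 : (0 : ℝ) ≤ k := k.cast_nonneg
    have hkk : (0 : ℝ) ≤ k * (k - 1) := by
      rcases k with _ | k
      · simp
      · push_cast
        ring_nf
        positivity
    have hP : (0 : ℝ) ≤ n.descFactorial k * (4 * n).descFactorial k := by positivity
    push_cast
    generalize ((2 * n).descFactorial k : ℝ) = F₂ at *
    generalize (n.descFactorial k : ℝ) = F₁ at *
    generalize ((4 * n).descFactorial k : ℝ) = F₄ at *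
    generalize (k : ℝ) = k at *
    generalize (n : ℝ) = n at *
    have factor : (8 * n + (k + 1) * k) * ((n - k) * (4 * n - k)) ≤
        (8 * n + k * (k - 1)) * (2 * n - k) ^ 2 := by
      nlinarith [mul_nonneg hkk (mul_nonneg hk0 (by linarith : 0 ≤ n)),
        mul_nonneg (mul_nonneg hk0 hk0) (by linarith : 0 ≤ 5 * n - k)]
    calc (8 * n + (k + 1) * (k + 1 - 1)) * ((n - k) * F₁ * ((4 * n - k) * F₄))
        = ((8 * n + (k + 1) * k) * ((n - k) * (4 * n - k))) * (F₁ * F₄) := by ring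
      _ ≤ ((8 * n + k * (k - 1)) * (2 * n - k) ^ 2) * (F₁ * F₄) := by gcongr
      _ = (2 * n - k) ^ 2 * ((8 * n + k * (k - 1)) * (F₁ * F₄)) := by ring
      _ ≤ (2 * n - k) ^ 2 * (8 * n * F₂ ^ 2) := by gcongr
      _ = 8 * n * ((2 * n - k) * F₂) ^ 2 := by ring

lemma descFactorial_four_mul_le {n k : ℕ} (h : k ≤ n) :
    ((4 * n).descFactorial k : ℝ) ≤ 4 ^ k * (2 * n).descFactorial k := by
  induction k with
  | zero => simp
  | succ k ih =>
    have ih := ih (by omega)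
    rw [cast_descFactorial_succ (m := 4 * n) (by omega),
      cast_descFactorial_succ (m := 2 * n) (by omega)]
    have hk : (k : ℝ) + 1 ≤ n := by exact_mod_cast h
    push_cast
    calc (4 * n - k : ℝ) * (4 * n).descFactorial k
        ≤ (4 * (2 * n - k)) * (4 ^ k * (2 * n).descFactorial k) := by
          gcongr <;> linarith
      _ = _ := by ring

lemma add_lt_of_sq_lt_of_le {C a b c p : ℝ} (hC : 0 < C) (hb : 0 < b)
    (h : 4 * C ^ 2 * (a * c) < b ^ 2) (hp : 2 * (p * c) ≤ b) :
    C * Real.sqrt (a * c) + p * c < b := by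
  have : Real.sqrt (a * c) < b / (2 * C) := by
    rw [Real.sqrt_lt' (by positivity), div_pow, lt_div_iff₀ (by positivity)]
    linarith
  rw [lt_div_iff₀ (by positivity)] at this
  linarith

theorem stmt_12 (ε : ℝ) (hε : 0 < ε) (n₀ : ℕ) (C : ℝ) (hC : 0 < C) :
    ∃ d₀ : ℕ, ∀ d : ℕ, d₀ < d →
      ∃ u : (Fin d → ℤ) → ℝ, (∀ x, latticeLap d u x = 0) ∧
        ∃ n : ℕ, n₀ < n ∧
          growthQ d u (2 * n) >
            C * Real.sqrt (growthQ d u n * growthQ d u (4 * n))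
              + (2 : ℝ) ^ (-((n : ℝ) ^ ((0.5 : ℝ) + ε))) * growthQ d u (4 * n) := by
  obtain ⟨M, hM⟩ := exists_nat_ge (32 * C ^ 2 + 2)
  have large : ∀ᶠ s : ℕ in Filter.atTop, (2 * M + 1 : ℝ) ≤ (s : ℝ) ^ (2 * ε) :=
    ((tendsto_rpow_atTop (by positivity)).comp tendsto_natCast_atTop_atTop).eventually_ge_atTop _
  obtain ⟨s, hs, hsM, hsn⟩ := (large.and ((Filter.eventually_ge_atTop M).and
    (Filter.eventually_gt_atTop n₀))).exists
  have hM2 : (2 : ℝ) ≤ M := by nlinarith [sq_nonneg C]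
  have hs1 : (1 : ℝ) ≤ s := by exact_mod_cast (by omega : 1 ≤ s)
  have hk : M * s ≤ s ^ 2 := by nlinarith
  refine ⟨M * s, fun d hd => ?_⟩
  have hd0 : 0 < d := by omega
  obtain ⟨S, hS⟩ : ∃ S : Finset (Fin d), S.card = M * s := by
    obtain ⟨S, -, hS⟩ := Finset.exists_subset_card_eq
      (s := (Finset.univ : Finset (Fin d))) (n := M * s) (by simpa using hd.le)
    exact ⟨S, hS⟩
  refine ⟨fun x => ∏ j ∈ S, (x j : ℝ), latticeLap_prod_coord hd0 S, s ^ 2, by nlinarith, ?_⟩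
  simp only [growthQ_prod_coord hd0, hS]
  have hD : (0 : ℝ) < (d : ℝ) ^ (M * s) := by positivity
  have pos (m : ℕ) (hm : M * s ≤ m) : (0 : ℝ) < m.descFactorial (M * s) := by
    exact_mod_cast Nat.pos_of_ne_zero (by rw [Ne, Nat.descFactorial_eq_zero_iff_lt]; omega)
  have convex := descFactorial_sq_ge hk
  have ratio := descFactorial_four_mul_le hk
  have h₁ := pos (s ^ 2) hk
  have h₂ := pos (2 * s ^ 2) (by omega)
  have h₄ := pos (4 * s ^ 2) (by omega)
  push_cast at convex ⊢
  generalize ((s ^ 2).descFactorial (M * s) : ℝ) = F₁ at *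
  generalize ((2 * s ^ 2).descFactorial (M * s) : ℝ) = F₂ at *
  generalize ((4 * s ^ 2).descFactorial (M * s) : ℝ) = F₄ at *
  generalize (d : ℝ) ^ (M * s) = D at *
  refine add_lt_of_sq_lt_of_le hC (by positivity) ?_ ?_
  · have growth : 32 * C ^ 2 * (s : ℝ) ^ 2 < 8 * s ^ 2 + M * s * (M * s - 1) := by
      have h1 : (M : ℝ) * (M - 1) * s ^ 2 ≤ M * s * (M * s - 1) := by
        nlinarith [mul_nonneg (mul_nonneg (by linarith : (0 : ℝ) ≤ M) (by linarith : (0 : ℝ) ≤ s))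
          (by linarith : (0 : ℝ) ≤ s - 1)]
      have h2 : 32 * C ^ 2 ≤ (M : ℝ) * (M - 1) := by nlinarith
      nlinarith [sq_pos_of_pos (by linarith : (0 : ℝ) < s)]
    have : 4 * C ^ 2 * (F₁ * F₄) < F₂ ^ 2 := by
      refine lt_of_mul_lt_mul_left (a := 8 * (s : ℝ) ^ 2) ?_ (by positivity)
      calc 8 * (s : ℝ) ^ 2 * (4 * C ^ 2 * (F₁ * F₄))
          = 32 * C ^ 2 * (s : ℝ) ^ 2 * (F₁ * F₄) := by ring
        _ < (8 * s ^ 2 + M * s * (M * s - 1)) * (F₁ * F₄) := by gcongr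
        _ ≤ _ := convex
    calc 4 * C ^ 2 * (F₁ / D * (F₄ / D)) = 4 * C ^ 2 * (F₁ * F₄) / D ^ 2 := by field_simp
      _ < F₂ ^ 2 / D ^ 2 := by gcongr
      _ = (F₂ / D) ^ 2 := by rw [div_pow]
  · have exponent : (2 * (M * s : ℕ) + 1 : ℝ) ≤ ((s : ℝ) ^ 2) ^ ((0.5 : ℝ) + ε) := by
      have : ((s : ℝ) ^ 2) ^ ((0.5 : ℝ) + ε) = s * (s : ℝ) ^ (2 * ε) := by
        rw [← Real.rpow_natCast, ← Real.rpow_mul (by positivity), mul_add,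
          Real.rpow_add (by linarith)]
        norm_num
      rw [this]
      push_cast
      nlinarith
    have small : 2 * (2 : ℝ) ^ (-((s : ℝ) ^ 2) ^ ((0.5 : ℝ) + ε)) * 4 ^ (M * s) ≤ 1 := by
      calc 2 * (2 : ℝ) ^ (-((s : ℝ) ^ 2) ^ ((0.5 : ℝ) + ε)) * 4 ^ (M * s)
          ≤ 2 * (2 : ℝ) ^ (-(2 * (M * s : ℕ) + 1 : ℝ)) * 4 ^ (M * s) := by
            gcongr
            norm_num
        _ = 1 := by
            rw [Real.rpow_neg (by norm_num), Real.rpow_add (by norm_num),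
              Real.rpow_mul (by norm_num), Real.rpow_natCast]
            norm_num
            field_simp
    rw [mul_div_assoc', mul_div_assoc']
    gcongr
    set p := (2 : ℝ) ^ (-((s : ℝ) ^ 2) ^ ((0.5 : ℝ) + ε))
    have hp : 0 < p := by positivity
    calc 2 * (p * F₄) ≤ 2 * (p * (4 ^ (M * s) * F₂)) := by gcongr
      _ = (2 * p * 4 ^ (M * s)) * F₂ := by ring
      _ ≤ 1 * F₂ := by gcongr
      _ = F₂ := one_mul _
end
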